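/- Let X = λ₂Q + λ₃n be an isotropic vector field along α with λ₂, λ₃ : ℝ → ℝ smooth. Then X is Fermi–Walker transported along α if and only if λ₂κ_g + λ₃κ_n = 0 identically and there exist constants c₁, c₂ such that λ₂(x) = c₁ cos(∫₁ˣ τ_g(t) dt) + c₂ sin(∫₁ˣ τ_g(t) dt) and λ₃(x) = c₂ cos(∫₁ˣ τ_g(t) dt) − c₁ sin(∫₁ˣ τ_g(t) dt) for all x. -/

import Mathlib

/-- The Galilean scalar product on `ℝ³`: `v₁w₁` if `v₁ ≠ 0` or `w₁ ≠ 0`,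
and `v₂w₂ + v₃w₃` if `v₁ = 0` and `w₁ = 0`. -/
noncomputable def gProd (v w : Fin 3 → ℝ) : ℝ :=
  if v 0 ≠ 0 ∨ w 0 ≠ 0 then v 0 * w 0 else v 1 * w 1 + v 2 * w 2

/-- The admissible curve `α(x) = (x, y(x), z(x))` in Galilean 3-space. -/
noncomputable def curve (y z : ℝ → ℝ) : ℝ → Fin 3 → ℝ :=
  fun x => ![x, y x, z x]

/-- The Fermi–Walker derivative along `α = curve y z`:
`∇̃_T X = X' − ⟨T,X⟩A + ⟨A,X⟩T`, where `T = α'` and `A = T' = α''`. -/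
noncomputable def FW (y z : ℝ → ℝ) (X : ℝ → Fin 3 → ℝ) (x : ℝ) : Fin 3 → ℝ :=
  deriv X x
    - gProd (deriv (curve y z) x) (X x) • deriv (deriv (curve y z)) x
    + gProd (deriv (deriv (curve y z)) x) (X x) • deriv (curve y z) x

/-- The tangent `T = α' = (1, y', z')`. -/
noncomputable def Tvec (y z : ℝ → ℝ) (x : ℝ) : Fin 3 → ℝ :=
  ![1, deriv y x, deriv z x]

/-- The curvature `κ = √(y''² + z''²)`. -/
noncomputable def kappa (y z : ℝ → ℝ) (x : ℝ) : ℝ :=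
  Real.sqrt (deriv (deriv y) x ^ 2 + deriv (deriv z) x ^ 2)

/-- The principal normal `N = (1/κ)(0, y'', z'')`. -/
noncomputable def Nvec (y z : ℝ → ℝ) (x : ℝ) : Fin 3 → ℝ :=
  (kappa y z x)⁻¹ • ![0, deriv (deriv y) x, deriv (deriv z) x]

/-- The binormal `B = (1/κ)(0, −z'', y'')`. -/
noncomputable def Bvec (y z : ℝ → ℝ) (x : ℝ) : Fin 3 → ℝ :=
  (kappa y z x)⁻¹ • ![0, -deriv (deriv z) x, deriv (deriv y) x]

/-- The torsion `τ = det(α', α'', α''') / κ²`. -/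
noncomputable def tors (y z : ℝ → ℝ) (x : ℝ) : ℝ :=
  (Matrix.of ![![(1 : ℝ), deriv y x, deriv z x],
    ![0, deriv (deriv y) x, deriv (deriv z) x],
    ![0, deriv (deriv (deriv y)) x, deriv (deriv (deriv z)) x]]).det / kappa y z x ^ 2

section PlaneFrame

variable {q₁ q₂ n₁ n₂ : ℝ}

/-- Expansion of a plane vector in an orthonormal basis. -/
theorem plane_orthonormal_expansion (hq : q₁ ^ 2 + q₂ ^ 2 = 1) (hn : n₁ ^ 2 + n₂ ^ 2 = 1)
    (hqn : q₁ * n₁ + q₂ * n₂ = 0) (v₁ v₂ : ℝ) :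
    v₁ = (v₁ * q₁ + v₂ * q₂) * q₁ + (v₁ * n₁ + v₂ * n₂) * n₁ ∧
      v₂ = (v₁ * q₁ + v₂ * q₂) * q₂ + (v₁ * n₁ + v₂ * n₂) * n₂ := by
  obtain ⟨s, hs⟩ : ∃ s, s = q₁ * n₂ - q₂ * n₁ := ⟨_, rfl⟩
  have h₁ : n₁ = -(q₂ * s) := by
    rw [hs]; linear_combination (-n₁) * hq + q₁ * hqn
  have h₂ : n₂ = q₁ * s := by
    rw [hs]; linear_combination (-n₂) * hq + q₂ * hqn
  have hs₂ : s ^ 2 = 1 := by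
    rw [h₁, h₂] at hn
    linear_combination hn - s ^ 2 * hq
  rw [h₁, h₂]
  constructor
  · linear_combination (-v₁) * hq + (v₂ * q₁ * q₂ - v₁ * q₂ ^ 2) * hs₂
  · linear_combination (-v₂) * hq + (v₁ * q₁ * q₂ - v₂ * q₁ ^ 2) * hs₂

theorem plane_orthonormal_combination_eq_zero_iff (hq : q₁ ^ 2 + q₂ ^ 2 = 1)
    (hn : n₁ ^ 2 + n₂ ^ 2 = 1) (hqn : q₁ * n₁ + q₂ * n₂ = 0) (a b : ℝ) :
    a * q₁ + b * n₁ = 0 ∧ a * q₂ + b * n₂ = 0 ↔ a = 0 ∧ b = 0 := by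
  constructor
  · rintro ⟨h₁, h₂⟩
    constructor
    · linear_combination q₁ * h₁ + q₂ * h₂ - a * hq - b * hqn
    · linear_combination n₁ * h₁ + n₂ * h₂ - b * hn - a * hqn
  · rintro ⟨rfl, rfl⟩
    simp

end PlaneFrame

/-- The rotation system `u' = θ' v`, `v' = -θ' u` is solved exactly by rotations by the angle `θ`
of constant vectors. -/
theorem rotation_system_iff {u v u' v' θ θ' : ℝ → ℝ} (hu : ∀ x, HasDerivAt u (u' x) x)
    (hv : ∀ x, HasDerivAt v (v' x) x) (hθ : ∀ x, HasDerivAt θ (θ' x) x) :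
    (∀ x, u' x = θ' x * v x ∧ v' x = -(θ' x * u x)) ↔
      ∃ c₁ c₂ : ℝ, ∀ x, u x = c₁ * Real.cos (θ x) + c₂ * Real.sin (θ x) ∧
        v x = c₂ * Real.cos (θ x) - c₁ * Real.sin (θ x) := by
  constructor
  · intro h
    have hconst₁ : ∀ x, HasDerivAt (fun x => u x * Real.cos (θ x) - v x * Real.sin (θ x)) 0 x := by
      intro x
      refine (((hu x).mul (hθ x).cos).sub ((hv x).mul (hθ x).sin)).congr_deriv ?_
      rw [(h x).1, (h x).2]
      ring
    have hconst₂ : ∀ x, HasDerivAt (fun x => u x * Real.sin (θ x) + v x * Real.cos (θ x)) 0 x := by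
      intro x
      refine (((hu x).mul (hθ x).sin).add ((hv x).mul (hθ x).cos)).congr_deriv ?_
      rw [(h x).1, (h x).2]
      ring
    refine ⟨u 0 * Real.cos (θ 0) - v 0 * Real.sin (θ 0),
      u 0 * Real.sin (θ 0) + v 0 * Real.cos (θ 0), fun x => ?_⟩
    have e₁ := is_const_of_deriv_eq_zero (fun x => (hconst₁ x).differentiableAt)
      (fun x => (hconst₁ x).deriv) x 0
    have e₂ := is_const_of_deriv_eq_zero (fun x => (hconst₂ x).differentiableAt)
      (fun x => (hconst₂ x).deriv) x 0
    have hcs := Real.sin_sq_add_cos_sq (θ x)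
    rw [← e₁, ← e₂]
    constructor
    · linear_combination (-u x) * hcs
    · linear_combination (-v x) * hcs
  · rintro ⟨c₁, c₂, h⟩ x
    have hu_eq : u = fun x => c₁ * Real.cos (θ x) + c₂ * Real.sin (θ x) :=
      funext fun x => (h x).1
    have hv_eq : v = fun x => c₂ * Real.cos (θ x) - c₁ * Real.sin (θ x) :=
      funext fun x => (h x).2
    have hu₂ := ((hθ x).cos.const_mul c₁).add ((hθ x).sin.const_mul c₂)
    have hv₂ := ((hθ x).cos.const_mul c₂).sub ((hθ x).sin.const_mul c₁)
    have hu₁ := hu x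
    have hv₁ := hv x
    rw [hu_eq] at hu₁
    rw [hv_eq] at hv₁
    rw [hu₁.unique hu₂, hv₁.unique hv₂, (h x).1, (h x).2]
    constructor <;> ring

theorem gProd_of_isotropic {v w : Fin 3 → ℝ} (hv : v 0 = 0) (hw : w 0 = 0) :
    gProd v w = v 1 * w 1 + v 2 * w 2 := by
  simp [gProd, hv, hw]

theorem HasDerivAt.vec3 {f g h : ℝ → ℝ} {f' g' h' x : ℝ} (hf : HasDerivAt f f' x)
    (hg : HasDerivAt g g' x) (hh : HasDerivAt h h' x) :
    HasDerivAt (fun t => ![f t, g t, h t]) ![f', g', h'] x := by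
  rw [hasDerivAt_pi]
  intro i
  fin_cases i <;> assumption

theorem deriv_curve {y z : ℝ → ℝ} (hy : Differentiable ℝ y) (hz : Differentiable ℝ z) :
    deriv (curve y z) = Tvec y z :=
  funext fun x => ((hasDerivAt_id x).vec3 (hy x).hasDerivAt (hz x).hasDerivAt).deriv

theorem deriv_Tvec {y z : ℝ → ℝ} (hy : Differentiable ℝ (deriv y))
    (hz : Differentiable ℝ (deriv z)) (x : ℝ) :
    deriv (Tvec y z) x = ![0, deriv (deriv y) x, deriv (deriv z) x] :=
  ((hasDerivAt_const x (1 : ℝ)).vec3 (hy x).hasDerivAt (hz x).hasDerivAt).deriv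

/-- The Fermi–Walker derivative of an isotropic field vanishes iff the field is stationary and
orthogonal to the acceleration. -/
theorem FW_eq_zero_iff_of_isotropic {y z : ℝ → ℝ} (hy : ContDiff ℝ 2 y) (hz : ContDiff ℝ 2 z)
    {X : ℝ → Fin 3 → ℝ} {X' : Fin 3 → ℝ} {x : ℝ} (hX : HasDerivAt X X' x)
    (hiso : ∀ t, X t 0 = 0) :
    FW y z X x = 0 ↔ gProd (deriv (deriv (curve y z)) x) (X x) = 0 ∧ X' 1 = 0 ∧ X' 2 = 0 := by
  have hX'₀ : X' 0 = 0 := by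
    have h := hasDerivAt_pi.1 hX 0
    simp only [hiso] at h
    exact h.unique (hasDerivAt_const x 0)
  have hTX : gProd (deriv (curve y z) x) (X x) = 0 := by
    rw [deriv_curve (hy.differentiable two_ne_zero) (hz.differentiable two_ne_zero)]
    simp [gProd, Tvec, hiso]
  rw [FW, hTX, hX.deriv]
  generalize gProd (deriv (deriv (curve y z)) x) (X x) = c
  rw [deriv_curve (hy.differentiable two_ne_zero) (hz.differentiable two_ne_zero)]
  constructor
  · intro h
    have h₀ := congrFun h 0
    have h₁ := congrFun h 1
    have h₂ := congrFun h 2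
    simp [Tvec, hX'₀] at h₀ h₁ h₂
    subst h₀
    simp only [zero_mul, add_zero] at h₁ h₂
    exact ⟨rfl, h₁, h₂⟩
  · rintro ⟨rfl, h₁, h₂⟩
    ext i
    fin_cases i <;> simp [hX'₀, h₁, h₂]

/-- The derivative equations of an isotropic orthonormal frame. -/
theorem isotropic_frame_deriv {Q n : ℝ → Fin 3 → ℝ} {Q' n' : Fin 3 → ℝ} {x : ℝ}
    (hQ : HasDerivAt Q Q' x) (hn : HasDerivAt n n' x)
    (hQQ : ∀ x, Q x 1 ^ 2 + Q x 2 ^ 2 = 1) (hnn : ∀ x, n x 1 ^ 2 + n x 2 ^ 2 = 1)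
    (hQn : ∀ x, Q x 1 * n x 1 + Q x 2 * n x 2 = 0) {τ : ℝ}
    (hτ : τ = Q' 1 * n x 1 + Q' 2 * n x 2) :
    (Q' 1 = τ * n x 1 ∧ Q' 2 = τ * n x 2) ∧ n' 1 = -(τ * Q x 1) ∧ n' 2 = -(τ * Q x 2) := by
  rw [hasDerivAt_pi] at hQ hn
  have hQ'Q := ((hQ 1).pow 2).add ((hQ 2).pow 2) |>.congr_of_eventuallyEq
    (.of_forall fun t => (hQQ t).symm) |>.unique (hasDerivAt_const x 1)
  have hn'n := ((hn 1).pow 2).add ((hn 2).pow 2) |>.congr_of_eventuallyEq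
    (.of_forall fun t => (hnn t).symm) |>.unique (hasDerivAt_const x 1)
  have hQ'n := ((hQ 1).mul (hn 1)).add ((hQ 2).mul (hn 2)) |>.congr_of_eventuallyEq
    (.of_forall fun t => (hQn t).symm) |>.unique (hasDerivAt_const x 0)
  simp only [Nat.cast_ofNat, Nat.add_one_sub_one, pow_one] at hQ'Q hn'n
  obtain ⟨eQ₁, eQ₂⟩ := plane_orthonormal_expansion (hQQ x) (hnn x) (hQn x) (Q' 1) (Q' 2)
  obtain ⟨en₁, en₂⟩ := plane_orthonormal_expansion (hQQ x) (hnn x) (hQn x) (n' 1) (n' 2)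
  refine ⟨⟨?_, ?_⟩, ?_, ?_⟩
  · linear_combination eQ₁ + Q x 1 / 2 * hQ'Q - n x 1 * hτ
  · linear_combination eQ₂ + Q x 2 / 2 * hQ'Q - n x 2 * hτ
  · linear_combination en₁ + n x 1 / 2 * hn'n + Q x 1 * hτ + Q x 1 * hQ'n
  · linear_combination en₂ + n x 2 / 2 * hn'n + Q x 2 * hτ + Q x 2 * hQ'n

/-- an isotropic field `X = λ₂Q + λ₃n` is Fermi–Walker transported iff
`λ₂κ_g + λ₃κ_n = 0` identically and `λ₂, λ₃` are the stated cosine/sine combinations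
of `∫₁ˣ τ_g`. -/
theorem fermiWalker_transported_isotropic_darboux_iff
(y z : ℝ → ℝ) (hy : ContDiff ℝ (⊤ : ℕ∞) y) (hz : ContDiff ℝ (⊤ : ℕ∞) z)
    (Q n : ℝ → Fin 3 → ℝ) (hQ : ContDiff ℝ (⊤ : ℕ∞) Q) (hn : ContDiff ℝ (⊤ : ℕ∞) n)
    (hQiso : ∀ x, Q x 0 = 0) (hniso : ∀ x, n x 0 = 0)
    (hQQ : ∀ x, Q x 1 ^ 2 + Q x 2 ^ 2 = 1)
    (hnn : ∀ x, n x 1 ^ 2 + n x 2 ^ 2 = 1)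
    (hQn : ∀ x, Q x 1 * n x 1 + Q x 2 * n x 2 = 0)
(kg kn : ℝ → ℝ)
    (hkg : ∀ x, kg x = gProd (deriv (deriv (curve y z)) x) (Q x))
    (hkn : ∀ x, kn x = gProd (deriv (deriv (curve y z)) x) (n x))
(tg : ℝ → ℝ) (htg : ∀ x, tg x = gProd (deriv Q x) (n x))
    (lam₂ lam₃ : ℝ → ℝ) (h₂ : ContDiff ℝ (⊤ : ℕ∞) lam₂) (h₃ : ContDiff ℝ (⊤ : ℕ∞) lam₃)
    (X : ℝ → Fin 3 → ℝ) (hX : ∀ x, X x = lam₂ x • Q x + lam₃ x • n x) :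
    (∀ x : ℝ, FW y z X x = 0) ↔
      ((∀ x : ℝ, lam₂ x * kg x + lam₃ x * kn x = 0) ∧ ∃ c₁ c₂ : ℝ, ∀ x : ℝ,
        lam₂ x = c₁ * Real.cos (∫ t in (1:ℝ)..x, tg t)
               + c₂ * Real.sin (∫ t in (1:ℝ)..x, tg t) ∧
        lam₃ x = c₂ * Real.cos (∫ t in (1:ℝ)..x, tg t)
               - c₁ * Real.sin (∫ t in (1:ℝ)..x, tg t)) := by
  have hle : (2 : WithTop ℕ∞) ≤ ((⊤ : ℕ∞) : WithTop ℕ∞) :=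
    WithTop.coe_le_coe.2 (le_top (a := (2 : ℕ∞)))
  have hne : ((⊤ : ℕ∞) : WithTop ℕ∞) ≠ 0 := by simp
  have hQd x : HasDerivAt Q (deriv Q x) x := (hQ.differentiable hne x).hasDerivAt
  have hnd x : HasDerivAt n (deriv n x) x := (hn.differentiable hne x).hasDerivAt
  have h₂d x : HasDerivAt lam₂ (deriv lam₂ x) x := (h₂.differentiable hne x).hasDerivAt
  have h₃d x : HasDerivAt lam₃ (deriv lam₃ x) x := (h₃.differentiable hne x).hasDerivAt
  have hXd x := ((h₂d x).smul (hQd x)).add ((h₃d x).smul (hnd x)) |>.congr_of_eventuallyEq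
    (.of_forall hX)
  have hXiso x : X x 0 = 0 := by simp [hX, hQiso, hniso]
  have hA x : deriv (deriv (curve y z)) x 0 = 0 := by
    rw [deriv_curve (hy.differentiable hne) (hz.differentiable hne), deriv_Tvec
      ((hy.of_le hle).differentiable_deriv_two) ((hz.of_le hle).differentiable_deriv_two)]
    rfl
  have hQ'iso x : deriv Q x 0 = 0 := by
    have h := hasDerivAt_pi.1 (hQd x) 0
    simp only [hQiso] at h
    exact h.unique (hasDerivAt_const x 0)
  have htg' x : tg x = deriv Q x 1 * n x 1 + deriv Q x 2 * n x 2 := by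
    rw [htg, gProd_of_isotropic (hQ'iso x) (hniso x)]
  have hAX x : gProd (deriv (deriv (curve y z)) x) (X x) = lam₂ x * kg x + lam₃ x * kn x := by
    rw [hkg, hkn, gProd_of_isotropic (hA x) (hXiso x), gProd_of_isotropic (hA x) (hQiso x),
      gProd_of_isotropic (hA x) (hniso x), hX]
    simp only [Pi.add_apply, Pi.smul_apply, smul_eq_mul]
    ring
  have htgc : Continuous tg := by
    have hQ' := hQ.continuous_deriv (one_le_two.trans hle)
    have hnc := hn.continuous
    rw [funext htg']
    fun_prop
  have hθ x : HasDerivAt (fun x => ∫ t in (1:ℝ)..x, tg t) (tg x) x :=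
    (htgc.integral_hasStrictDerivAt 1 x).hasDerivAt
  rw [← rotation_system_iff h₂d h₃d hθ, ← forall_and]
  refine forall_congr' fun x => ?_
  rw [FW_eq_zero_iff_of_isotropic (hy.of_le hle) (hz.of_le hle) (hXd x) hXiso, hAX]
  obtain ⟨⟨eQ₁, eQ₂⟩, en₁, en₂⟩ :=
    isotropic_frame_deriv (hQd x) (hnd x) hQQ hnn hQn (htg' x)
  refine and_congr_right fun _ => ?_
  rw [← sub_eq_zero (b := tg x * lam₃ x), ← sub_eq_zero (b := -(tg x * lam₂ x)),
    ← plane_orthonormal_combination_eq_zero_iff (hQQ x) (hnn x) (hQn x)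
      (deriv lam₂ x - tg x * lam₃ x)]
  simp only [Pi.add_apply, Pi.smul_apply, smul_eq_mul, eQ₁, eQ₂, en₁, en₂]
  ring_nf
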